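/- arXiv:2009.09489 — 6 statements merged into one kernel-verified Lean document; each statement's English description precedes it below -/
import Mathlib

section
/- Let u, w : ℝ × ℝ → ℝ be smooth functions satisfying the Bäcklund relations ∂_x(u − w) = sin(u + w) and ∂_y(u + w) = sin(u − w) at every point of ℝ². Then the function 2u satisfies the sine-Gordon equation, i.e. ∂_x∂_y(2u) = sin(2u) at every point. -/
open Real

/-- Partial derivative in the first coordinate. -/
noncomputable def pdx (f : ℝ × ℝ → ℝ) (p : ℝ × ℝ) : ℝ := fderiv ℝ f p (1, 0)

/-- Partial derivative in the second coordinate. -/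
noncomputable def pdy (f : ℝ × ℝ → ℝ) (p : ℝ × ℝ) : ℝ := fderiv ℝ f p (0, 1)

lemma ContDiff.differentiable_pdy {f : ℝ × ℝ → ℝ} (hf : ContDiff ℝ 2 f) :
    Differentiable ℝ (pdy f) :=
  ((hf.fderiv_right (m := 1) (by norm_num)).clm_apply contDiff_const).differentiable one_ne_zero

lemma pdx_add {f g : ℝ × ℝ → ℝ} {p : ℝ × ℝ} (hf : DifferentiableAt ℝ f p)
    (hg : DifferentiableAt ℝ g p) : pdx (fun q => f q + g q) p = pdx f p + pdx g p := by
  simp [pdx, fderiv_fun_add hf hg]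

lemma pdy_add {f g : ℝ × ℝ → ℝ} {p : ℝ × ℝ} (hf : DifferentiableAt ℝ f p)
    (hg : DifferentiableAt ℝ g p) : pdy (fun q => f q + g q) p = pdy f p + pdy g p := by
  simp [pdy, fderiv_fun_add hf hg]

lemma pdx_sin {f : ℝ × ℝ → ℝ} {p : ℝ × ℝ} (hf : DifferentiableAt ℝ f p) :
    pdx (fun q => sin (f q)) p = cos (f p) * pdx f p := by
  simp [pdx, fderiv_sin hf]

lemma pdy_sin {f : ℝ × ℝ → ℝ} {p : ℝ × ℝ} (hf : DifferentiableAt ℝ f p) :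
    pdy (fun q => sin (f q)) p = cos (f p) * pdy f p := by
  simp [pdy, fderiv_sin hf]

/-- Mixed partial derivatives of a `C²` function commute. -/
lemma pdx_pdy_comm {f : ℝ × ℝ → ℝ} (hf : ContDiff ℝ 2 f) (p : ℝ × ℝ) :
    pdx (pdy f) p = pdy (pdx f) p := by
  have hd : DifferentiableAt ℝ (fderiv ℝ f) p :=
    (hf.fderiv_right (m := 1) (by norm_num)).differentiable one_ne_zero p
  have hsymm : IsSymmSndFDerivAt ℝ f p := hf.contDiffAt.isSymmSndFDerivAt (by simp)
  have key (v w : ℝ × ℝ) :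
      fderiv ℝ (fun q => fderiv ℝ f q v) p w = fderiv ℝ (fderiv ℝ f) p w v := by
    simp [fderiv_clm_apply hd (differentiableAt_const v)]
  exact (key _ _).trans ((hsymm _ _).trans (key _ _).symm)

/-- If smooth `u, w` satisfy the Bäcklund relations, then `2u` satisfies the
sine-Gordon equation. -/
theorem backlund_implies_sineGordon_u
    (u w : ℝ × ℝ → ℝ) (hu : ContDiff ℝ (⊤ : ℕ∞) u) (hw : ContDiff ℝ (⊤ : ℕ∞) w)
    (hB1 : ∀ p : ℝ × ℝ, pdx (fun q => u q - w q) p = Real.sin (u p + w p))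
    (hB2 : ∀ p : ℝ × ℝ, pdy (fun q => u q + w q) p = Real.sin (u p - w p)) :
    ∀ p : ℝ × ℝ, pdx (pdy (fun q => 2 * u q)) p = Real.sin (2 * u p) := by
  intro p
  have ha : ContDiff ℝ 2 (fun q => u q - w q) := contDiff_infty.1 (hu.sub hw) 2
  have hb : ContDiff ℝ 2 (fun q => u q + w q) := contDiff_infty.1 (hu.add hw) 2
  have ha' := ha.differentiable two_ne_zero
  have hb' := hb.differentiable two_ne_zero
  have hsplit : pdy (fun q => 2 * u q) =
      fun q => pdy (fun q => u q - w q) q + pdy (fun q => u q + w q) q := by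
    funext q
    rw [← pdy_add (ha' q) (hb' q)]
    congr 1
    funext r
    ring
  rw [hsplit, pdx_add (ha.differentiable_pdy p) (hb.differentiable_pdy p), pdx_pdy_comm ha,
    funext hB1, funext hB2, pdy_sin (hb' p), pdx_sin (ha' p), hB1, hB2,
    show 2 * u p = (u p + w p) + (u p - w p) by ring, sin_add (u p + w p)]
  ring
end

section
/- Let u, w : ℝ × ℝ → ℝ be smooth functions satisfying the Bäcklund relations ∂_x(u − w) = sin(u + w) and ∂_y(u + w) = sin(u − w) at every point of ℝ². Then the 1-form cos(u + w) dx + cos(u − w) dy is closed, i.e. ∂_y(cos(u + w)) = ∂_x(cos(u − w)) at every point of ℝ² (Bianchi's nonlocal conservation law of the sine-Gordon equation). -/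
open Real

theorem pdx_cos {f : ℝ × ℝ → ℝ} {p : ℝ × ℝ} (hf : DifferentiableAt ℝ f p) :
    pdx (fun q => Real.cos (f q)) p = -Real.sin (f p) * pdx f p := by
  simp [pdx, hf.hasFDerivAt.cos.fderiv]

theorem pdy_cos {f : ℝ × ℝ → ℝ} {p : ℝ × ℝ} (hf : DifferentiableAt ℝ f p) :
    pdy (fun q => Real.cos (f q)) p = -Real.sin (f p) * pdy f p := by
  simp [pdy, hf.hasFDerivAt.cos.fderiv]

/-- Bianchi's nonlocal conservation law: if smooth `u, w` satisfy the Bäcklund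
relations then the 1-form `cos(u+w) dx + cos(u-w) dy` is closed. -/
theorem bianchi_conservation_law
    (u w : ℝ × ℝ → ℝ) (hu : ContDiff ℝ (⊤ : ℕ∞) u) (hw : ContDiff ℝ (⊤ : ℕ∞) w)
    (hB1 : ∀ p : ℝ × ℝ, pdx (fun q => u q - w q) p = Real.sin (u p + w p))
    (hB2 : ∀ p : ℝ × ℝ, pdy (fun q => u q + w q) p = Real.sin (u p - w p)) :
    ∀ p : ℝ × ℝ,
      pdy (fun q => Real.cos (u q + w q)) p = pdx (fun q => Real.cos (u q - w q)) p := by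
  intro p
  have hu' : DifferentiableAt ℝ u p := hu.differentiable (by simp) p
  have hw' : DifferentiableAt ℝ w p := hw.differentiable (by simp) p
  rw [pdy_cos (f := fun q => u q + w q) (hu'.add hw'),
    pdx_cos (f := fun q => u q - w q) (hu'.sub hw'), hB1, hB2]
  ring
end

section
/- Let u : ℝ × ℝ → ℝ be a smooth function and define F, G : ℝ × ℝ × ℝ → ℝ by F(x, y, s) = ∂_x u(x, y) − sin(u(x, y) + s) and G(x, y, s) = sin(u(x, y) − s) − ∂_y u(x, y). Then for every (x, y, s) one has ∂_y F + G·∂_s F − ∂_x G − F·∂_s G = 2 ∂_x∂_y u(x, y) − sin(2 u(x, y)). In particular, the compatibility condition ∂_y F + G·∂_s F = ∂_x G + F·∂_s G of the overdetermined system w_x = F(x, y, w), w_y = G(x, y, w) holds for all (x, y, s) if and only if 2u satisfies the sine-Gordon equation ∂_x∂_y(2u) = sin(2u) everywhere. -/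
open Real

/-- Partial derivative in the first of three coordinates. -/
noncomputable def pdx3 (f : ℝ × ℝ × ℝ → ℝ) (p : ℝ × ℝ × ℝ) : ℝ := fderiv ℝ f p (1, 0, 0)

/-- Partial derivative in the second of three coordinates. -/
noncomputable def pdy3 (f : ℝ × ℝ × ℝ → ℝ) (p : ℝ × ℝ × ℝ) : ℝ := fderiv ℝ f p (0, 1, 0)

/-- Partial derivative in the third of three coordinates. -/
noncomputable def pds3 (f : ℝ × ℝ × ℝ → ℝ) (p : ℝ × ℝ × ℝ) : ℝ := fderiv ℝ f p (0, 0, 1)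

/-- Mixed partial derivatives of a smooth function commute. -/
theorem pdy_pdx_comm {u : ℝ × ℝ → ℝ} (hu : ContDiff ℝ (⊤ : ℕ∞) u) (q : ℝ × ℝ) :
    pdy (pdx u) q = pdx (pdy u) q := by
  have hd : DifferentiableAt ℝ (fderiv ℝ u) q :=
    ((contDiff_infty.1 hu 2).fderiv_right (m := 1) (by norm_num)).differentiable one_ne_zero q
  have key (v w : ℝ × ℝ) : fderiv ℝ (fun z => fderiv ℝ u z v) q w
      = fderiv ℝ (fderiv ℝ u) q w v := by
    rw [(hd.hasFDerivAt.clm_apply (hasFDerivAt_const v q)).fderiv]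
    simp
  have hsymm : IsSymmSndFDerivAt ℝ u q :=
    (contDiff_infty.1 hu 2).contDiffAt.isSymmSndFDerivAt (by simp [minSmoothness_of_isRCLikeNormedField])
  exact (key _ _).trans ((hsymm.eq _ _).trans (key _ _).symm)

theorem differentiable_fderiv_apply {u : ℝ × ℝ → ℝ} (hu : ContDiff ℝ (⊤ : ℕ∞) u)
    (v : ℝ × ℝ) : Differentiable ℝ (fun z => fderiv ℝ u z v) :=
  (((contDiff_infty.1 hu 2).fderiv_right (m := 1) (by norm_num)).differentiable
    one_ne_zero).clm_apply (differentiable_const v)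

/-- The projection of `ℝ × ℝ × ℝ` onto its first two coordinates. -/
noncomputable def projXY : ℝ × ℝ × ℝ →L[ℝ] ℝ × ℝ :=
  (ContinuousLinearMap.fst ℝ ℝ (ℝ × ℝ)).prod
    ((ContinuousLinearMap.fst ℝ ℝ ℝ).comp (ContinuousLinearMap.snd ℝ ℝ (ℝ × ℝ)))

theorem hasFDerivAt_comp_projXY {f : ℝ × ℝ → ℝ} (hf : Differentiable ℝ f) (p : ℝ × ℝ × ℝ) :
    HasFDerivAt (fun r : ℝ × ℝ × ℝ => f (r.1, r.2.1))
      ((fderiv ℝ f (p.1, p.2.1)).comp projXY) p :=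
  (hf (p.1, p.2.1)).hasFDerivAt.comp p projXY.hasFDerivAt

theorem hasFDerivAt_third (p : ℝ × ℝ × ℝ) :
    HasFDerivAt (fun r : ℝ × ℝ × ℝ => r.2.2)
      ((ContinuousLinearMap.snd ℝ ℝ ℝ).comp (ContinuousLinearMap.snd ℝ ℝ (ℝ × ℝ))) p :=
  ((ContinuousLinearMap.snd ℝ ℝ ℝ).comp (ContinuousLinearMap.snd ℝ ℝ (ℝ × ℝ))).hasFDerivAt

theorem pdx_pdy_two_mul {u : ℝ × ℝ → ℝ} (hu : ContDiff ℝ (⊤ : ℕ∞) u) (q : ℝ × ℝ) :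
    pdx (pdy (fun z => 2 * u z)) q = 2 * pdx (pdy u) q := by
  have hud : Differentiable ℝ u := hu.differentiable (by simp)
  have h : pdy (fun z => 2 * u z) = fun z => 2 * pdy u z := by
    funext z
    simp only [pdy]
    rw [((hud z).hasFDerivAt.const_mul 2).fderiv]
    simp
  have hy : Differentiable ℝ (pdy u) := differentiable_fderiv_apply hu (0, 1)
  rw [h]
  simp only [pdx]
  rw [((hy q).hasFDerivAt.const_mul 2).fderiv]
  simp

/-- The compatibility (flatness) condition of the Bäcklund covering of the
sine-Gordon equation holds identically iff `2u` satisfies sine-Gordon, and the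
defect is exactly `2 u_{xy} - sin(2u)`. -/
theorem backlund_covering_compatibility
    (u : ℝ × ℝ → ℝ) (hu : ContDiff ℝ (⊤ : ℕ∞) u)
    (F G : ℝ × ℝ × ℝ → ℝ)
    (hF : ∀ p : ℝ × ℝ × ℝ, F p = pdx u (p.1, p.2.1) - Real.sin (u (p.1, p.2.1) + p.2.2))
    (hG : ∀ p : ℝ × ℝ × ℝ, G p = Real.sin (u (p.1, p.2.1) - p.2.2) - pdy u (p.1, p.2.1)) :
    (∀ p : ℝ × ℝ × ℝ,
      pdy3 F p + G p * pds3 F p - pdx3 G p - F p * pds3 G p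
        = 2 * pdx (pdy u) (p.1, p.2.1) - Real.sin (2 * u (p.1, p.2.1))) ∧
    ((∀ p : ℝ × ℝ × ℝ, pdy3 F p + G p * pds3 F p = pdx3 G p + F p * pds3 G p) ↔
      (∀ q : ℝ × ℝ, pdx (pdy (fun z => 2 * u z)) q = Real.sin (2 * u q))) := by
  have hud : Differentiable ℝ u := hu.differentiable (by simp)
  have hx : Differentiable ℝ (pdx u) := differentiable_fderiv_apply hu (1, 0)
  have hy : Differentiable ℝ (pdy u) := differentiable_fderiv_apply hu (0, 1)
  have defect : ∀ p : ℝ × ℝ × ℝ,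
      pdy3 F p + G p * pds3 F p - pdx3 G p - F p * pds3 G p
        = 2 * pdx (pdy u) (p.1, p.2.1) - Real.sin (2 * u (p.1, p.2.1)) := by
    intro p
    have dF := (hasFDerivAt_comp_projXY hx p).sub
      ((hasFDerivAt_comp_projXY hud p).add (hasFDerivAt_third p)).sin
    have dG := ((hasFDerivAt_comp_projXY hud p).sub (hasFDerivAt_third p)).sin.sub
      (hasFDerivAt_comp_projXY hy p)
    replace dF := (dF.congr_of_eventuallyEq (Filter.Eventually.of_forall hF)).fderiv
    replace dG := (dG.congr_of_eventuallyEq (Filter.Eventually.of_forall hG)).fderiv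
    have zero : ((0 : ℝ), (0 : ℝ)) = 0 := rfl
    have hFy : pdy3 F p = pdy (pdx u) (p.1, p.2.1)
        - Real.cos (u (p.1, p.2.1) + p.2.2) * pdy u (p.1, p.2.1) := by
      rw [pdy3, dF]; simp [projXY, pdy]
    have hFs : pds3 F p = - Real.cos (u (p.1, p.2.1) + p.2.2) := by
      rw [pds3, dF]; simp [projXY, zero]
    have hGx : pdx3 G p = Real.cos (u (p.1, p.2.1) - p.2.2) * pdx u (p.1, p.2.1)
        - pdx (pdy u) (p.1, p.2.1) := by
      rw [pdx3, dG]; simp [projXY, pdx]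
    have hGs : pds3 G p = - Real.cos (u (p.1, p.2.1) - p.2.2) := by
      rw [pds3, dG]; simp [projXY, zero]
    have hsin : Real.sin (2 * u (p.1, p.2.1))
        = Real.sin ((u (p.1, p.2.1) + p.2.2) + (u (p.1, p.2.1) - p.2.2)) := by
      congr 1; ring
    rw [Real.sin_add] at hsin
    rw [hFy, hFs, hGx, hGs, hF, hG, pdy_pdx_comm hu, hsin]
    ring
  refine ⟨defect, fun h q => ?_, fun h p => ?_⟩
  · have h1 := defect (q.1, q.2, 0)
    have h2 := h (q.1, q.2, 0)
    rw [pdx_pdy_two_mul hu]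
    simp only [Prod.mk.eta] at h1
    linarith
  · have h1 := defect p
    have h2 := h (p.1, p.2.1)
    rw [pdx_pdy_two_mul hu] at h2
    linarith
end

section
/- Let X, T : ℝ × ℝ × ℝ → ℝ be smooth functions (arguments written (x, t, s)) satisfying the compatibility identity ∂_t X + T·∂_s X = ∂_x T + X·∂_s T at every point (x, t, s), and let w : ℝ × ℝ → ℝ be a smooth function with ∂_x w(x, t) = X(x, t, w(x, t)) and ∂_t w(x, t) = T(x, t, w(x, t)) for all (x, t). Then ∂_t[(∂_s X)(x, t, w(x, t))] = ∂_x[(∂_s T)(x, t, w(x, t))] for all (x, t); that is, the 1-form (∂_s X)(x, t, w(x, t)) dx + (∂_s T)(x, t, w(x, t)) dt is closed along any solution of the covering. -/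
open Real

theorem contDiff_fderiv_apply_const {f : ℝ × ℝ × ℝ → ℝ} (hf : ContDiff ℝ (⊤ : ℕ∞) f)
    (v : ℝ × ℝ × ℝ) : ContDiff ℝ (⊤ : ℕ∞) (fun p => fderiv ℝ f p v) :=
  (hf.fderiv_right (by simp)).clm_apply contDiff_const

/-- Mixed directional derivatives of a smooth function commute. -/
theorem fderiv_fderiv_apply_comm {f : ℝ × ℝ × ℝ → ℝ} (hf : ContDiff ℝ (⊤ : ℕ∞) f)
    (p u v : ℝ × ℝ × ℝ) :
    fderiv ℝ (fun q => fderiv ℝ f q u) p v = fderiv ℝ (fun q => fderiv ℝ f q v) p u := by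
  have hd : DifferentiableAt ℝ (fderiv ℝ f) p :=
    (hf.fderiv_right (m := (⊤ : ℕ∞)) (by simp)).differentiable (by simp) p
  have hsymm : IsSymmSndFDerivAt ℝ f p :=
    hf.contDiffAt.isSymmSndFDerivAt (by
      rw [minSmoothness_of_isRCLikeNormedField]
      exact WithTop.coe_le_coe.2 le_top)
  rw [fderiv_clm_apply hd (differentiableAt_const u), fderiv_clm_apply hd (differentiableAt_const v)]
  simpa using hsymm.eq v u

/-- Chain rule for a function of three variables restricted to the graph of `w`. -/
theorem fderiv_comp_graph_apply {g : ℝ × ℝ × ℝ → ℝ} {w : ℝ × ℝ → ℝ} (hg : Differentiable ℝ g)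
    (hw : Differentiable ℝ w) (p v : ℝ × ℝ) :
    fderiv ℝ (fun q : ℝ × ℝ => g (q.1, q.2, w q)) p v
      = fderiv ℝ g (p.1, p.2, w p) (v.1, v.2, fderiv ℝ w p v) := by
  have hγ : HasFDerivAt (fun q : ℝ × ℝ => (q.1, q.2, w q)) _ p :=
    hasFDerivAt_fst.prodMk (hasFDerivAt_snd.prodMk (hw p).hasFDerivAt)
  exact congrArg (fun L => L v)
    ((hg (p.1, p.2, w p)).hasFDerivAt.comp (f := fun q : ℝ × ℝ => (q.1, q.2, w q)) p hγ).fderiv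

/-- Bianchi's mechanism: for a compatible one-dimensional covering
`w_x = X(x,t,w)`, `w_t = T(x,t,w)`, the 1-form `X_s dx + T_s dt` evaluated along
any solution `w` is closed. -/
theorem covering_gives_closed_form_along_solutions
    (X T : ℝ × ℝ × ℝ → ℝ) (hX : ContDiff ℝ (⊤ : ℕ∞) X) (hT : ContDiff ℝ (⊤ : ℕ∞) T)
    (hcompat : ∀ p : ℝ × ℝ × ℝ,
      pdy3 X p + T p * pds3 X p = pdx3 T p + X p * pds3 T p)
    (w : ℝ × ℝ → ℝ) (hw : ContDiff ℝ (⊤ : ℕ∞) w)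
    (hwx : ∀ p : ℝ × ℝ, pdx w p = X (p.1, p.2, w p))
    (hwt : ∀ p : ℝ × ℝ, pdy w p = T (p.1, p.2, w p)) :
    ∀ p : ℝ × ℝ,
      pdy (fun q => pds3 X (q.1, q.2, w q)) p
        = pdx (fun q => pds3 T (q.1, q.2, w q)) p := by
  intro p
  have hdX : Differentiable ℝ X := hX.differentiable (by simp)
  have hdT : Differentiable ℝ T := hT.differentiable (by simp)
  have hdw : Differentiable ℝ w := hw.differentiable (by simp)
  have hd {f : ℝ × ℝ × ℝ → ℝ} (hf : ContDiff ℝ (⊤ : ℕ∞) f) (v : ℝ × ℝ × ℝ) :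
      Differentiable ℝ (fun q => fderiv ℝ f q v) :=
    (contDiff_fderiv_apply_const hf v).differentiable (by simp)
  unfold pdx pdy pdx3 pdy3 pds3 at *
  rw [fderiv_comp_graph_apply (hd hX _) hdw, fderiv_comp_graph_apply (hd hT _) hdw, hwx, hwt]
  set P : ℝ × ℝ × ℝ := (p.1, p.2, w p)
  have hs : fderiv ℝ (fun q => fderiv ℝ X q (0, 1, 0) + T q * fderiv ℝ X q (0, 0, 1)) P (0, 0, 1)
      = fderiv ℝ (fun q => fderiv ℝ T q (1, 0, 0) + X q * fderiv ℝ T q (0, 0, 1)) P (0, 0, 1) := by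
    rw [funext hcompat]
  rw [fderiv_fun_add (hd hX _ P) ((hdT P).fun_mul (hd hX _ P)),
    fderiv_fun_add (hd hT _ P) ((hdX P).fun_mul (hd hT _ P)),
    fderiv_fun_mul (hdT P) (hd hX _ P), fderiv_fun_mul (hdX P) (hd hT _ P)] at hs
  simp only [add_apply, smul_apply, smul_eq_mul,
    fderiv_fderiv_apply_comm hX P (0, 1, 0), fderiv_fderiv_apply_comm hT P (1, 0, 0)] at hs
  have hvt : ((0, 1, T P) : ℝ × ℝ × ℝ) = (0, 1, 0) + T P • (0, 0, 1) := by simp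
  have hvx : ((1, 0, X P) : ℝ × ℝ × ℝ) = (1, 0, 0) + X P • (0, 0, 1) := by simp
  rw [hvt, hvx, map_add, map_add, map_smul, map_smul, smul_eq_mul, smul_eq_mul]
  linarith
end

section
/- Let u : ℝ × ℝ → ℝ be a smooth function and define X, T : ℝ × ℝ × ℝ → ℝ by X(x, t, s) = u(x, t) + s²/6 and T(x, t, s) = ∂_x² u(x, t) + (1/3) s ∂_x u(x, t) + (1/3) u(x, t)² + (1/18) s² u(x, t). Then for every (x, t, s) one has ∂_t X + T·∂_s X − ∂_x T − X·∂_s T = ∂_t u(x, t) − u(x, t) ∂_x u(x, t) − ∂_x³ u(x, t). In particular, the compatibility condition ∂_t X + T·∂_s X = ∂_x T + X·∂_s T of the Miura covering holds for all (x, t, s) if and only if u is a solution of the KdV equation ∂_t u = u ∂_x u + ∂_x³ u everywhere. -/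
open Real

/-- The partial derivative in the first coordinate of a smooth function is smooth. -/
theorem contDiff_pdx {f : ℝ × ℝ → ℝ} (hf : ContDiff ℝ (⊤ : ℕ∞) f) :
    ContDiff ℝ (⊤ : ℕ∞) (pdx f) :=
  (hf.fderiv_right (m := (⊤ : ℕ∞)) (by simp)).clm_apply contDiff_const

/-- Derivative of a function on the plane, regarded as a function of three variables. -/
theorem hasFDerivAt_comp_fst_snd_fst {f : ℝ × ℝ → ℝ} (hf : Differentiable ℝ f)
    (p : ℝ × ℝ × ℝ) :
    HasFDerivAt (fun p : ℝ × ℝ × ℝ => f (p.1, p.2.1))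
      ((fderiv ℝ f (p.1, p.2.1)).comp
        ((ContinuousLinearMap.fst ℝ ℝ (ℝ × ℝ)).prod
          ((ContinuousLinearMap.fst ℝ ℝ ℝ).comp (ContinuousLinearMap.snd ℝ ℝ (ℝ × ℝ))))) p :=
  (hf _).hasFDerivAt.comp p
    (hasFDerivAt_fst.prodMk (hasFDerivAt_fst.comp p hasFDerivAt_snd))

/-- The compatibility condition of the Miura covering holds identically iff `u`
solves the KdV equation; the defect is exactly `u_t - u u_x - u_xxx`. -/
theorem miura_covering_compatibility
    (u : ℝ × ℝ → ℝ) (hu : ContDiff ℝ (⊤ : ℕ∞) u)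
    (X T : ℝ × ℝ × ℝ → ℝ)
    (hX : ∀ p : ℝ × ℝ × ℝ, X p = u (p.1, p.2.1) + p.2.2 ^ 2 / 6)
    (hT : ∀ p : ℝ × ℝ × ℝ,
      T p = pdx (pdx u) (p.1, p.2.1) + (1 / 3) * p.2.2 * pdx u (p.1, p.2.1)
        + (1 / 3) * (u (p.1, p.2.1)) ^ 2 + (1 / 18) * p.2.2 ^ 2 * u (p.1, p.2.1)) :
    (∀ p : ℝ × ℝ × ℝ,
      pdy3 X p + T p * pds3 X p - pdx3 T p - X p * pds3 T p
        = pdy u (p.1, p.2.1) - u (p.1, p.2.1) * pdx u (p.1, p.2.1)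
          - pdx (pdx (pdx u)) (p.1, p.2.1)) ∧
    ((∀ p : ℝ × ℝ × ℝ, pdy3 X p + T p * pds3 X p = pdx3 T p + X p * pds3 T p) ↔
      (∀ q : ℝ × ℝ, pdy u q = u q * pdx u q + pdx (pdx (pdx u)) q)) := by
  have key : ∀ p : ℝ × ℝ × ℝ,
      pdy3 X p + T p * pds3 X p - pdx3 T p - X p * pds3 T p
        = pdy u (p.1, p.2.1) - u (p.1, p.2.1) * pdx u (p.1, p.2.1)
          - pdx (pdx (pdx u)) (p.1, p.2.1) := by
    intro p
    have hu₁ := contDiff_pdx hu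
    have hu₂ := contDiff_pdx hu₁
    have d₀ := hasFDerivAt_comp_fst_snd_fst (hu.differentiable (by simp)) p
    have d₁ := hasFDerivAt_comp_fst_snd_fst (hu₁.differentiable (by simp)) p
    have d₂ := hasFDerivAt_comp_fst_snd_fst (hu₂.differentiable (by simp)) p
    have ds : HasFDerivAt (fun p : ℝ × ℝ × ℝ => p.2.2) _ p :=
      (hasFDerivAt_snd (𝕜 := ℝ) (p := p.2)).comp p hasFDerivAt_snd
    have dX := (d₀.add ((ds.pow 2).mul_const (1 / 6))).congr_of_eventuallyEq
      (f₁ := X) (.of_forall fun q => by simp [hX, div_eq_mul_inv])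
    have dT := (((d₂.add ((ds.const_mul (1 / 3)).mul d₁)).add
      ((d₀.pow 2).const_mul (1 / 3))).add
      (((ds.pow 2).const_mul (1 / 18)).mul d₀)).congr_of_eventuallyEq
      (f₁ := T) (.of_forall fun q => by simp [hT])
    have hz (f : ℝ × ℝ → ℝ) (q : ℝ × ℝ) : fderiv ℝ f q (0, 0) = 0 := map_zero _
    have hx (f : ℝ × ℝ → ℝ) (q : ℝ × ℝ) : fderiv ℝ f q (1, 0) = pdx f q := rfl
    have hy (f : ℝ × ℝ → ℝ) (q : ℝ × ℝ) : fderiv ℝ f q (0, 1) = pdy f q := rfl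
    simp only [pdy3, pds3, pdx3, dX.fderiv, dT.fderiv, hX, hT]
    simp [hz, hx, hy]
    ring
  refine ⟨key, fun h q => ?_, fun h p => ?_⟩
  · linarith [key (q.1, q.2, 0), h (q.1, q.2, 0)]
  · linarith [key p, h (p.1, p.2.1)]
end

section
/- Let λ ∈ ℝ, let u : ℝ × ℝ → ℝ be a smooth solution of the potential KdV equation ∂_t u = 3(∂_x u)² + ∂_x³ u, and define X, T : ℝ × ℝ × ℝ → ℝ by X(x, t, s) = λ − ∂_x u − (1/2)(s − u)² and T(x, t, s) = 2λ² − 2λ ∂_x u − (∂_x u)² − ∂_x³ u + 2(∂_x² u)(s − u) − (λ + ∂_x u)(s − u)², where u and its derivatives are evaluated at (x, t). Then the compatibility identity ∂_t X + T·∂_s X = ∂_x T + X·∂_s T holds at every point (x, t, s) ∈ ℝ³. -/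
open Real

/-- Partial derivatives of a `C²` function commute. -/
theorem pdy_pdx_comm_s12 {f : ℝ × ℝ → ℝ} (hf : ContDiff ℝ 2 f) (p : ℝ × ℝ) :
    pdy (pdx f) p = pdx (pdy f) p := by
  have hd : DifferentiableAt ℝ (fderiv ℝ f) p :=
    (hf.fderiv_right (m := 1) (by norm_num)).differentiable (by norm_num) p
  have hsymm : IsSymmSndFDerivAt ℝ f p := hf.contDiffAt.isSymmSndFDerivAt (by simp)
  have key (v w : ℝ × ℝ) :
      fderiv ℝ (fun q => fderiv ℝ f q v) p w = fderiv ℝ (fderiv ℝ f) p w v := by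
    rw [fderiv_clm_apply hd (differentiableAt_const v)]
    simp
  change fderiv ℝ (fun q => fderiv ℝ f q (1, 0)) p (0, 1) =
    fderiv ℝ (fun q => fderiv ℝ f q (0, 1)) p (1, 0)
  rw [key, key]
  exact hsymm _ _

/-- The projection of `ℝ³` onto its first two coordinates. -/
noncomputable def projFstSnd : ℝ × ℝ × ℝ →L[ℝ] ℝ × ℝ :=
  (ContinuousLinearMap.fst ℝ ℝ (ℝ × ℝ)).prod
    ((ContinuousLinearMap.fst ℝ ℝ ℝ).comp (ContinuousLinearMap.snd ℝ ℝ (ℝ × ℝ)))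

theorem hasFDerivAt_comp_projFstSnd {f : ℝ × ℝ → ℝ} (hf : ContDiff ℝ (⊤ : ℕ∞) f)
    (p : ℝ × ℝ × ℝ) :
    HasFDerivAt (fun q : ℝ × ℝ × ℝ => f (q.1, q.2.1))
      ((fderiv ℝ f (p.1, p.2.1)).comp projFstSnd) p :=
  ((hf.differentiable (by simp) (p.1, p.2.1)).hasFDerivAt).comp p projFstSnd.hasFDerivAt

/-- The Bäcklund covering of the potential KdV equation is compatible whenever
`u` solves the potential KdV equation. -/
theorem pkdv_backlund_covering_compatible
    (lam : ℝ) (u : ℝ × ℝ → ℝ) (hu : ContDiff ℝ (⊤ : ℕ∞) u)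
    (hpkdv : ∀ p : ℝ × ℝ, pdy u p = 3 * (pdx u p) ^ 2 + pdx (pdx (pdx u)) p)
    (X T : ℝ × ℝ × ℝ → ℝ)
    (hX : ∀ p : ℝ × ℝ × ℝ,
      X p = lam - pdx u (p.1, p.2.1) - (1 / 2) * (p.2.2 - u (p.1, p.2.1)) ^ 2)
    (hT : ∀ p : ℝ × ℝ × ℝ,
      T p = 2 * lam ^ 2 - 2 * lam * pdx u (p.1, p.2.1) - (pdx u (p.1, p.2.1)) ^ 2
        - pdx (pdx (pdx u)) (p.1, p.2.1)
        + 2 * pdx (pdx u) (p.1, p.2.1) * (p.2.2 - u (p.1, p.2.1))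
        - (lam + pdx u (p.1, p.2.1)) * (p.2.2 - u (p.1, p.2.1)) ^ 2) :
    ∀ p : ℝ × ℝ × ℝ,
      pdy3 X p + T p * pds3 X p = pdx3 T p + X p * pds3 T p := by
  intro p
  have hs : HasFDerivAt (fun q : ℝ × ℝ × ℝ => q.2.2)
      ((ContinuousLinearMap.snd ℝ ℝ ℝ).comp (ContinuousLinearMap.snd ℝ ℝ (ℝ × ℝ))) p :=
    ((ContinuousLinearMap.snd ℝ ℝ ℝ).comp
      (ContinuousLinearMap.snd ℝ ℝ (ℝ × ℝ))).hasFDerivAt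
  have h0 := hasFDerivAt_comp_projFstSnd hu p
  have h1 := hasFDerivAt_comp_projFstSnd (contDiff_pdx hu) p
  have h2 := hasFDerivAt_comp_projFstSnd (contDiff_pdx (contDiff_pdx hu)) p
  have h3 := hasFDerivAt_comp_projFstSnd (contDiff_pdx (contDiff_pdx (contDiff_pdx hu))) p
  have hv := hs.sub h0
  have hdX := ((h1.const_sub lam).sub ((hv.pow 2).const_mul (1 / 2))).congr_of_eventuallyEq
    (Filter.Eventually.of_forall hX)
  have hdT := ((((((h1.const_mul (2 * lam)).const_sub (2 * lam ^ 2)).sub (h1.pow 2)).sub h3).add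
    ((h2.const_mul 2).mul hv)).sub ((h1.const_add lam).mul (hv.pow 2))).congr_of_eventuallyEq
    (Filter.Eventually.of_forall hT)
  have hxt : pdy (pdx u) (p.1, p.2.1) =
      6 * pdx u (p.1, p.2.1) * pdx (pdx u) (p.1, p.2.1) +
        pdx (pdx (pdx (pdx u))) (p.1, p.2.1) := by
    rw [pdy_pdx_comm_s12 (contDiff_infty.1 hu 2), funext hpkdv]
    have hd (f : ℝ × ℝ → ℝ) (hf : ContDiff ℝ (⊤ : ℕ∞) f) :
        HasFDerivAt f (fderiv ℝ f (p.1, p.2.1)) (p.1, p.2.1) :=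
      (hf.differentiable (by simp) _).hasFDerivAt
    have h := ((((hd _ (contDiff_pdx hu)).pow 2).const_mul 3).add
      (hd _ (contDiff_pdx (contDiff_pdx (contDiff_pdx hu))))).fderiv
    refine (congrArg (fun L => L (1, 0)) h).trans ?_
    simp [pdx]
    ring
  have ht := hpkdv (p.1, p.2.1)
  have e0 : projFstSnd (1, 0, 0) = (1, 0) := rfl
  have e1 : projFstSnd (0, 1, 0) = (0, 1) := rfl
  have e2 : projFstSnd (0, 0, 1) = 0 := rfl
  have hXt : pdy3 X p = -pdy (pdx u) (p.1, p.2.1)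
      + (p.2.2 - u (p.1, p.2.1)) * pdy u (p.1, p.2.1) := by
    rw [pdy3, hdX.fderiv]
    simp [e1, pdy]
    ring
  have hXs : pds3 X p = -(p.2.2 - u (p.1, p.2.1)) := by
    rw [pds3, hdX.fderiv]
    simp [e2]
  have hTx : pdx3 T p = -2 * lam * pdx (pdx u) (p.1, p.2.1)
      - 4 * pdx u (p.1, p.2.1) * pdx (pdx u) (p.1, p.2.1)
      - pdx (pdx (pdx (pdx u))) (p.1, p.2.1)
      + 2 * pdx (pdx (pdx u)) (p.1, p.2.1) * (p.2.2 - u (p.1, p.2.1))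
      - pdx (pdx u) (p.1, p.2.1) * (p.2.2 - u (p.1, p.2.1)) ^ 2
      + 2 * (lam + pdx u (p.1, p.2.1)) * (p.2.2 - u (p.1, p.2.1)) * pdx u (p.1, p.2.1) := by
    have hfold (f : ℝ × ℝ → ℝ) (q : ℝ × ℝ) : fderiv ℝ f q (1, 0) = pdx f q := rfl
    rw [pdx3, hdT.fderiv]
    simp [e0, hfold]
    ring
  have hTs : pds3 T p = 2 * pdx (pdx u) (p.1, p.2.1)
      - 2 * (lam + pdx u (p.1, p.2.1)) * (p.2.2 - u (p.1, p.2.1)) := by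
    rw [pds3, hdT.fderiv]
    simp [e2]
    ring
  rw [hXt, hXs, hTx, hTs, hxt, ht, hX, hT]
  ring
end
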